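/- arXiv:1803.10731 — 4 statements merged into one kernel-verified Lean document; each statement's English description precedes it below -/
import Mathlib

section
/- Let m be a positive integer and let σ, τ be perfect matchings of Fin(2m). The number of ordered pairs (α, β) of perfect matchings of Fin(2m) such that the multiset of edges E(α) + E(β) equals the multiset E(σ) + E(τ) is 2^{Γ(σ,τ)}, where Γ(σ,τ) is the number of connected components of the union graph G_{σ,τ} containing more than two vertices (i.e., the number of cycles of length at least 2 in the union of the two matchings). -/
open Finset

/-- A perfect matching permutation: a fixed-point-free involution. -/
def IsPerfMatch {n : ℕ} (σ : Equiv.Perm (Fin n)) : Prop :=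
  (∀ i, σ (σ i) = i) ∧ ∀ i, σ i ≠ i

instance {n : ℕ} : DecidablePred (IsPerfMatch (n := n)) := fun _ =>
  instDecidableAnd

/-- The finite set of perfect matching permutations of `Fin n`. -/
def PM (n : ℕ) : Finset (Equiv.Perm (Fin n)) := Finset.univ.filter IsPerfMatch

/-- The multiset of the edges `{i, σ i}` of a perfect matching permutation of `Fin n`. -/
def pmEdges {n : ℕ} (σ : Equiv.Perm (Fin n)) : Multiset (Sym2 (Fin n)) :=
  (Finset.univ.filter (fun i => i < σ i)).val.map (fun i => s(i, σ i))

/-- The union graph of two perfect matchings: `i` and `j` are adjacent iff `i ≠ j` and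
(`σ i = j` or `τ i = j`). -/
def unionGraph {n : ℕ} (σ τ : Equiv.Perm (Fin n)) : SimpleGraph (Fin n) :=
  SimpleGraph.fromRel (fun i j => σ i = j ∨ τ i = j)

theorem IsPerfMatch.eq_comm_apply {n : ℕ} {α : Equiv.Perm (Fin n)} (hα : IsPerfMatch α)
    {i j : Fin n} : α i = j ↔ α j = i :=
  ⟨fun h => h ▸ hα.1 i, fun h => h ▸ hα.1 j⟩

theorem count_pmEdges {n : ℕ} {α : Equiv.Perm (Fin n)} (hα : IsPerfMatch α) (i j : Fin n) :
    (pmEdges α).count s(i, j) = if α i = j then 1 else 0 := by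
  rw [pmEdges, Multiset.count_map, ← Finset.filter_val, Finset.card_val]
  split_ifs with h
  · have hji := hα.eq_comm_apply.1 h
    have hne : i ≠ j := fun e => hα.2 i (h.trans e.symm)
    rw [Finset.card_eq_one]
    rcases lt_or_gt_of_ne hne with hlt | hlt
    · refine ⟨i, ?_⟩
      ext k
      simp only [mem_filter, mem_univ, true_and, mem_singleton, Sym2.eq_iff]
      constructor
      · rintro ⟨hk, ⟨rfl, -⟩ | ⟨h1, rfl⟩⟩
        · rfl
        · rw [hji] at hk; exact absurd hk hlt.asymm
      · rintro rfl; exact ⟨h ▸ hlt, Or.inl ⟨rfl, h.symm⟩⟩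
    · refine ⟨j, ?_⟩
      ext k
      simp only [mem_filter, mem_univ, true_and, mem_singleton, Sym2.eq_iff]
      constructor
      · rintro ⟨hk, ⟨rfl, -⟩ | ⟨h1, rfl⟩⟩
        · rw [h] at hk; exact absurd hk hlt.asymm
        · rfl
      · rintro rfl; exact ⟨hji ▸ hlt, Or.inr ⟨hji.symm, rfl⟩⟩
  · rw [Finset.card_eq_zero, Finset.filter_eq_empty_iff]
    intro k _ hk
    rcases Sym2.eq_iff.1 hk with ⟨rfl, h2⟩ | ⟨h1, rfl⟩
    · exact h h2.symm
    · exact h (hα.eq_comm_apply.1 h1.symm)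

theorem pmEdges_add_eq_iff {n : ℕ} {α β σ τ : Equiv.Perm (Fin n)} (hα : IsPerfMatch α)
    (hβ : IsPerfMatch β) (hσ : IsPerfMatch σ) (hτ : IsPerfMatch τ) :
    pmEdges α + pmEdges β = pmEdges σ + pmEdges τ ↔
      ∀ i, (α i = σ i ∧ β i = τ i) ∨ (α i = τ i ∧ β i = σ i) := by
  simp only [Multiset.ext, Sym2.forall, Multiset.count_add, count_pmEdges hα, count_pmEdges hβ,
    count_pmEdges hσ, count_pmEdges hτ]
  refine forall_congr' fun i => ⟨fun h => ?_, fun h j => ?_⟩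
  · have h1 := h (σ i)
    have h2 := h (τ i)
    have h3 := h (α i)
    have h4 := h (β i)
    grind
  · rcases h with ⟨h1, h2⟩ | ⟨h1, h2⟩
    · rw [h1, h2]
    · rw [h1, h2, add_comm]

section UnionGraph

variable {n : ℕ} {σ τ : Equiv.Perm (Fin n)}

theorem unionGraph_connectedComponentMk_left (i : Fin n) :
    (unionGraph σ τ).connectedComponentMk (σ i) = (unionGraph σ τ).connectedComponentMk i := by
  by_cases h : σ i = i
  · rw [h]
  · exact SimpleGraph.ConnectedComponent.sound
      (SimpleGraph.Adj.reachable ⟨h, Or.inr (Or.inl rfl)⟩)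

theorem unionGraph_connectedComponentMk_right (i : Fin n) :
    (unionGraph σ τ).connectedComponentMk (τ i) = (unionGraph σ τ).connectedComponentMk i := by
  by_cases h : τ i = i
  · rw [h]
  · exact SimpleGraph.ConnectedComponent.sound
      (SimpleGraph.Adj.reachable ⟨h, Or.inr (Or.inr rfl)⟩)

/-- A predicate preserved by both matchings holds throughout a component of the union graph as
soon as it holds at one vertex. -/
theorem unionGraph_component_induction (hσ : IsPerfMatch σ) (hτ : IsPerfMatch τ)
    {p : Fin n → Prop} (hpσ : ∀ i, p i → p (σ i)) (hpτ : ∀ i, p i → p (τ i)) {i j : Fin n}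
    (hij : (unionGraph σ τ).connectedComponentMk i = (unionGraph σ τ).connectedComponentMk j)
    (hi : p i) : p j := by
  obtain ⟨w⟩ := SimpleGraph.ConnectedComponent.exact hij
  clear hij
  induction w with
  | nil => exact hi
  | cons h _ ih =>
    apply ih
    rcases h with ⟨-, (rfl | rfl) | (h | h)⟩
    · exact hpσ _ hi
    · exact hpτ _ hi
    · rw [← hσ.eq_comm_apply.1 h]; exact hpσ _ hi
    · rw [← hτ.eq_comm_apply.1 h]; exact hpτ _ hi

theorem two_lt_card_component_iff (hσ : IsPerfMatch σ) (hτ : IsPerfMatch τ) (i : Fin n) :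
    2 < Nat.card {v : Fin n // (unionGraph σ τ).connectedComponentMk v =
      (unionGraph σ τ).connectedComponentMk i} ↔ σ i ≠ τ i := by
  classical
  rw [Nat.card_eq_fintype_card, Fintype.card_subtype]
  constructor
  · intro h e
    refine absurd h
      (not_lt.2 ((Finset.card_le_card ?_).trans (Finset.card_le_two (a := i) (b := σ i))))
    intro v hv
    rw [mem_filter] at hv
    refine unionGraph_component_induction (p := fun v => v ∈ ({i, σ i} : Finset (Fin n))) hσ hτ
      ?_ ?_ hv.2.symm (by simp)
    · intro k hk
      rcases by simpa using hk with rfl | rfl <;> simp [hσ.1]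
    · intro k hk
      rcases by simpa using hk with rfl | rfl
      · simp [e]
      · simp [e, hτ.1]
  · intro h
    refine Finset.two_lt_card_iff.2 ⟨i, σ i, τ i, ?_, ?_, ?_, (hσ.2 i).symm, (hτ.2 i).symm, h⟩
    · simp
    · exact mem_filter.2 ⟨mem_univ _, unionGraph_connectedComponentMk_left i⟩
    · exact mem_filter.2 ⟨mem_univ _, unionGraph_connectedComponentMk_right i⟩

/-- The matching that uses the edges of `τ` on the components of the union graph marked by `g`,
and the edges of `σ` on the others. -/
def mixMatching (hσ : IsPerfMatch σ) (hτ : IsPerfMatch τ)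
    (g : (unionGraph σ τ).ConnectedComponent → Bool) : Equiv.Perm (Fin n) :=
  Function.Involutive.toPerm
    (fun i => if g ((unionGraph σ τ).connectedComponentMk i) then τ i else σ i) fun i => by
      by_cases h : g ((unionGraph σ τ).connectedComponentMk i) <;>
        simp [h, unionGraph_connectedComponentMk_left, unionGraph_connectedComponentMk_right,
          hσ.1, hτ.1]

theorem mixMatching_apply (hσ : IsPerfMatch σ) (hτ : IsPerfMatch τ)
    (g : (unionGraph σ τ).ConnectedComponent → Bool) (i : Fin n) :
    mixMatching hσ hτ g i =
      if g ((unionGraph σ τ).connectedComponentMk i) then τ i else σ i := rfl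

theorem isPerfMatch_mixMatching (hσ : IsPerfMatch σ) (hτ : IsPerfMatch τ)
    (g : (unionGraph σ τ).ConnectedComponent → Bool) : IsPerfMatch (mixMatching hσ hτ g) := by
  refine ⟨Function.Involutive.toPerm_involutive _, fun i => ?_⟩
  rw [mixMatching_apply]
  split_ifs
  · exact hτ.2 i
  · exact hσ.2 i

/-- If `α`, `β` distribute the edges of `σ`, `τ` among themselves, then which of the two matchings
`α` follows is constant on components of the union graph. -/
theorem apply_eq_right_of_component_eq (hσ : IsPerfMatch σ) (hτ : IsPerfMatch τ)
    {α β : Equiv.Perm (Fin n)} (hα : IsPerfMatch α) (hβ : IsPerfMatch β)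
    (h : ∀ i, (α i = σ i ∧ β i = τ i) ∨ (α i = τ i ∧ β i = σ i)) {i j : Fin n}
    (hij : (unionGraph σ τ).connectedComponentMk i = (unionGraph σ τ).connectedComponentMk j)
    (hi : α i = τ i) : α j = τ j := by
  have key : ∀ k, α k = τ k → β k = σ k := fun k hk => by
    rcases h k with h | h
    · rw [h.2, ← hk, h.1]
    · exact h.2
  refine unionGraph_component_induction (p := fun k => α k = τ k) hσ hτ ?_ ?_ hij hi
  · intro k hk
    have hb : β (σ k) = k := hβ.eq_comm_apply.1 (key k hk)
    rcases h (σ k) with h | h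
    · rw [h.1, hσ.1, ← h.2, hb]
    · exact h.1
  · intro k hk
    rw [hτ.1]
    exact hα.eq_comm_apply.1 hk

end UnionGraph

/-- The number of ordered pairs `(α, β)` of perfect matchings of `Fin 2m` whose combined edge
multiset `E(α) + E(β)` equals `E(σ) + E(τ)` is `2^{Γ(σ,τ)}`, where `Γ(σ,τ)` is the number of
connected components of the union graph of `σ` and `τ` containing more than two vertices. -/
theorem card_pairs_eq_two_pow_cycles (m : ℕ) (hm : 0 < m)
    (σ τ : Equiv.Perm (Fin (2 * m))) (hσ : IsPerfMatch σ) (hτ : IsPerfMatch τ) :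
    ((PM (2 * m) ×ˢ PM (2 * m)).filter
        (fun p => pmEdges p.1 + pmEdges p.2 = pmEdges σ + pmEdges τ)).card
      = 2 ^ Nat.card {c : (unionGraph σ τ).ConnectedComponent //
          2 < Nat.card {v : Fin (2 * m) // (unionGraph σ τ).connectedComponentMk v = c}} := by
  classical
  let G := unionGraph σ τ
  let big : G.ConnectedComponent → Prop := fun c =>
    2 < Nat.card {v : Fin (2 * m) // G.connectedComponentMk v = c}
  have hbig (i) : big (G.connectedComponentMk i) ↔ σ i ≠ τ i := two_lt_card_component_iff hσ hτ i
  let ext : ({c // big c} → Bool) → Bool → G.ConnectedComponent → Bool :=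
    fun f b c => if h : big c then xor b (f ⟨c, h⟩) else false
  let F : ({c // big c} → Bool) → Equiv.Perm (Fin (2 * m)) × Equiv.Perm (Fin (2 * m)) :=
    fun f => (mixMatching hσ hτ (ext f false), mixMatching hσ hτ (ext f true))
  have hF (f i) : ((F f).1 i = σ i ∧ (F f).2 i = τ i) ∨ ((F f).1 i = τ i ∧ (F f).2 i = σ i) := by
    by_cases h : big (G.connectedComponentMk i)
    · cases hf : f ⟨_, h⟩ <;> simp [F, ext, mixMatching_apply, G, h, hf]
    · have := not_not.1 (mt (hbig i).2 h)
      simp [F, mixMatching_apply, this]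
  have hcard : 2 ^ Nat.card {c // big c} = (univ : Finset ({c // big c} → Bool)).card := by
    simp
  refine Eq.trans (Eq.symm ?_) hcard.symm
  refine Finset.card_bij (fun f _ => F f) ?_ ?_ ?_
  · intro f _
    have h1 := isPerfMatch_mixMatching hσ hτ (ext f false)
    have h2 := isPerfMatch_mixMatching hσ hτ (ext f true)
    simp only [mem_filter, mem_product, PM, mem_univ, true_and]
    exact ⟨⟨h1, h2⟩, (pmEdges_add_eq_iff h1 h2 hσ hτ).2 (hF f)⟩
  · intro f _ f' _ hff
    funext ⟨c, hc⟩
    induction c using SimpleGraph.ConnectedComponent.ind with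
    | h i =>
      have h := (hbig i).1 hc
      have h1 := congrArg (fun p => p.1 i) hff
      simp only [F, mixMatching_apply, ext] at h1
      cases hf : f ⟨_, hc⟩ <;> cases hf' : f' ⟨_, hc⟩ <;> simp_all [G]
  · rintro ⟨α, β⟩ hab
    simp only [mem_filter, mem_product, PM, mem_univ, true_and] at hab
    obtain ⟨⟨hα, hβ⟩, hE⟩ := hab
    have hp := (pmEdges_add_eq_iff hα hβ hσ hτ).1 hE
    let f : {c // big c} → Bool := fun c => decide (α c.1.out = τ c.1.out)
    have hout (i) : G.connectedComponentMk (G.connectedComponentMk i).out =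
      G.connectedComponentMk i := Quot.out_eq _
    have hf (i) (h : big (G.connectedComponentMk i)) : f ⟨_, h⟩ = decide (α i = τ i) :=
      decide_eq_decide.2
        ⟨apply_eq_right_of_component_eq hσ hτ hα hβ hp (hout i),
          apply_eq_right_of_component_eq hσ hτ hα hβ hp (hout i).symm⟩
    have hFf (i) : (F f).1 i = α i ∧ (F f).2 i = β i := by
      by_cases h : big (G.connectedComponentMk i)
      · have hne := (hbig i).1 h
        have hfi := hf i h
        rcases hp i with ⟨h1, h2⟩ | ⟨h1, h2⟩ <;>
          simp_all [F, ext, mixMatching_apply, G]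
      · have := not_not.1 (mt (hbig i).2 h)
        have h1 := hp i
        have h2 := hF f i
        grind
    exact ⟨f, mem_univ _, Prod.ext (Equiv.ext fun i => (hFf i).1) (Equiv.ext fun i => (hFf i).2)⟩
end

section
/- For a nonnegative integer m, let g(m) = Σ over perfect matchings ξ of Fin(2m) of 2^{c(ξ)}, where c(ξ) is the number of connected components of the union graph of ξ and the fixed perfect matching σ₀ pairing the elements 2j−1 and 2j for each j = 1, …, m (with g(0) = 1 for the empty matching). Then for every m ≥ 1, g(m) = 2m·g(m−1). -/
open Finset

/-- The fixed perfect matching pairing `2j−1` with `2j` (1-based), i.e. `2j` with `2j+1`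
(0-based), for each `j = 1, …, m`. -/
def sigma0 (m : ℕ) : Equiv.Perm (Fin (2 * m)) :=
  Function.Involutive.toPerm
    (fun i => ⟨if i.val % 2 = 0 then i.val + 1 else i.val - 1, by
      have := i.isLt; split_ifs <;> omega⟩)
    (by
      intro i
      apply Fin.ext
      simp only
      split_ifs <;> omega)

/-- `g m = Σ_{ξ ∈ PM(2m)} 2^{c(ξ)}`, where `c(ξ)` is the number of connected components of
the union graph of `ξ` and the fixed matching `σ₀`. -/
noncomputable def g (m : ℕ) : ℕ :=
  ∑ ξ ∈ PM (2 * m), 2 ^ Nat.card (unionGraph ξ (sigma0 m)).ConnectedComponent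

/-- The fixed-point-free involutions of an arbitrary type. -/
abbrev Matching (V : Type*) : Type _ :=
  {ξ : Equiv.Perm V // (∀ i, ξ (ξ i) = i) ∧ ∀ i, ξ i ≠ i}

/-- The two-colorings of `V` invariant under both `s` and `ξ`. -/
abbrev InvariantColoring {V : Type*} (s ξ : Equiv.Perm V) : Type _ :=
  {f : V → Bool // ∀ v, f (ξ v) = f v ∧ f (s v) = f v}

/-- The number of pairs of a matching `ξ` and a two-coloring invariant under `s` and `ξ`. -/
noncomputable def coloredMatchings {V : Type*} [Fintype V] [DecidableEq V]
    (s : Equiv.Perm V) : ℕ :=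
  ∑ ξ : Matching V, Nat.card (InvariantColoring s ξ.1)

/-- Functions on the connected components are the functions that agree on adjacent vertices. -/
def SimpleGraph.connectedComponentFunctionEquiv {V : Type*} (G : SimpleGraph V) (β : Type*) :
    (G.ConnectedComponent → β) ≃ {f : V → β // ∀ v w, G.Adj v w → f v = f w} where
  toFun F := ⟨fun v => F (G.connectedComponentMk v), fun _ _ h =>
    congrArg F (SimpleGraph.ConnectedComponent.sound h.reachable)⟩
  invFun f := fun c => c.lift f.1 fun v w p _ => by
    induction p with
    | nil => rfl
    | cons h p ih => exact (f.2 _ _ h).trans (ih (by simp_all))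
  left_inv F := by
    funext c
    induction c using SimpleGraph.ConnectedComponent.ind
    rfl
  right_inv f := rfl

theorem two_pow_card_connectedComponent_unionGraph {n : ℕ} (ξ s : Equiv.Perm (Fin n)) :
    2 ^ Nat.card (unionGraph ξ s).ConnectedComponent = Nat.card (InvariantColoring s ξ) := by
  have h := Nat.card_congr ((unionGraph ξ s).connectedComponentFunctionEquiv Bool)
  rw [Nat.card_fun, Nat.card_eq_fintype_card (α := Bool), Fintype.card_bool] at h
  rw [h]
  refine Nat.card_congr (Equiv.subtypeEquivRight fun f => ?_)
  simp only [unionGraph, SimpleGraph.fromRel_adj]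
  constructor
  · intro hf v
    constructor
    · by_cases hv : ξ v = v
      · rw [hv]
      · exact (hf v (ξ v) ⟨Ne.symm hv, .inl (.inl rfl)⟩).symm
    · by_cases hv : s v = v
      · rw [hv]
      · exact (hf v (s v) ⟨Ne.symm hv, .inl (.inr rfl)⟩).symm
  · rintro hf v w ⟨-, (h | h) | (h | h)⟩ <;> subst h
    · exact (hf _).1.symm
    · exact (hf _).2.symm
    · exact (hf _).1
    · exact (hf _).2

theorem g_eq_coloredMatchings (m : ℕ) : g m = coloredMatchings (sigma0 m) := by
  unfold g coloredMatchings
  simp only [two_pow_card_connectedComponent_unionGraph]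
  exact Finset.sum_subtype _ (by simp [PM, IsPerfMatch])
    fun ξ : Equiv.Perm (Fin (2 * m)) => Nat.card (InvariantColoring (sigma0 m) ξ)

theorem coloredMatchings_congr {V W : Type*} [Fintype V] [DecidableEq V] [Fintype W]
    [DecidableEq W] (e : V ≃ W) (s : Equiv.Perm V) (t : Equiv.Perm W)
    (h : ∀ v, e (s v) = t (e v)) : coloredMatchings s = coloredMatchings t := by
  have h' (w : W) : e.symm (t w) = s (e.symm w) := by
    rw [Equiv.symm_apply_eq, h, Equiv.apply_symm_apply]
  refine Fintype.sum_equiv (e.permCongr.subtypeEquiv fun ξ => ?_) _ _ fun ξ => ?_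
  · simp [e.forall_congr_left, Equiv.permCongr_apply, ← Equiv.eq_symm_apply]
  · refine Nat.card_congr ((e.arrowCongr (Equiv.refl Bool)).subtypeEquiv fun f => ?_)
    simp [e.forall_congr_left, Equiv.permCongr_apply, h']

section AddPair

variable {α : Type*}

/-- Extend a permutation by a transposition of two new points. -/
def addPair (ξ : Equiv.Perm α) : Equiv.Perm (Option (Option α)) where
  toFun
    | none => some none
    | some none => none
    | some (some x) => some (some (ξ x))
  invFun
    | none => some none
    | some none => none
    | some (some x) => some (some (ξ.symm x))
  left_inv := by rintro (_ | _ | x) <;> simp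
  right_inv := by rintro (_ | _ | x) <;> simp

@[simp] theorem addPair_none (ξ : Equiv.Perm α) : addPair ξ none = some none := rfl

@[simp] theorem addPair_some_none (ξ : Equiv.Perm α) : addPair ξ (some none) = none := rfl

@[simp] theorem addPair_some_some (ξ : Equiv.Perm α) (x : α) :
    addPair ξ (some (some x)) = some (some (ξ x)) := rfl

theorem addPair_injective : Function.Injective (addPair (α := α)) := by
  intro ξ η h
  ext x
  simpa using congrArg (fun p => p (some (some x))) h

theorem exists_addPair_eq (η : Equiv.Perm (Option (Option α))) (h₀ : η none = some none)
    (h₁ : η (some none) = none) : ∃ ξ, addPair ξ = η := by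
  refine ⟨η.removeNone.removeNone, ?_⟩
  have h₂ : η.removeNone none = none := by
    apply Option.some_injective
    rw [Equiv.removeNone_none η h₁, h₀]
  ext1 v
  rcases v with _ | _ | x
  · simp [h₀]
  · simp [h₁]
  · obtain ⟨y, hy⟩ : ∃ y, η (some (some x)) = some (some y) := by
      rcases h : η (some (some x)) with _ | _ | y
      · exact absurd (η.injective (h.trans h₁.symm)) (by simp)
      · exact absurd (η.injective (h.trans h₀.symm)) (by simp)
      · exact ⟨y, rfl⟩
    have h₃ : η.removeNone (some x) = some y := by
      apply Option.some_injective
      rw [Equiv.removeNone_some η ⟨_, hy⟩, hy]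
    have h₄ : η.removeNone.removeNone x = y := by
      apply Option.some_injective
      rw [Equiv.removeNone_some η.removeNone ⟨_, h₃⟩, h₃]
    rw [addPair_some_some, h₄, hy]

theorem addPair_isMatching {ξ : Equiv.Perm α} :
    ((∀ i, addPair ξ (addPair ξ i) = i) ∧ ∀ i, addPair ξ i ≠ i) ↔
      (∀ i, ξ (ξ i) = i) ∧ ∀ i, ξ i ≠ i := by
  simp [Option.forall]

variable [DecidableEq α]

/-- Add two points to a matching, then conjugate so that the first is matched with `j`. -/
def insertPair (j : Option α) (ξ : Equiv.Perm α) : Equiv.Perm (Option (Option α)) :=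
  Equiv.swap (some none) (some j) * addPair ξ * Equiv.swap (some none) (some j)

theorem insertPair_none_apply (j : Option α) (ξ : Equiv.Perm α) :
    insertPair j ξ none = some j := by
  simp [insertPair, Equiv.swap_apply_of_ne_of_ne]

theorem conj_swap_isMatching {V : Type*} [DecidableEq V] (a b : V) (ξ : Equiv.Perm V)
    (h : (∀ i, ξ (ξ i) = i) ∧ ∀ i, ξ i ≠ i) :
    (∀ i, (Equiv.swap a b * ξ * Equiv.swap a b) ((Equiv.swap a b * ξ * Equiv.swap a b) i) = i) ∧
      ∀ i, (Equiv.swap a b * ξ * Equiv.swap a b) i ≠ i := by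
  refine ⟨fun i => by simp [h.1], fun i hi => h.2 (Equiv.swap a b i) ?_⟩
  simpa using congrArg (Equiv.swap a b) hi

/-- A matching with two extra points is a matching together with the partner of the first
extra point. -/
noncomputable def matchingOptionEquiv : Option α × Matching α ≃ Matching (Option (Option α)) :=
  Equiv.ofBijective
    (fun p => ⟨insertPair p.1 p.2.1, conj_swap_isMatching _ _ _ (addPair_isMatching.2 p.2.2)⟩) <| by
    constructor
    · rintro ⟨j, ξ⟩ ⟨k, η⟩ h
      have h := congrArg Subtype.val h
      dsimp only at h
      obtain rfl : j = k := by
        simpa [insertPair_none_apply] using congrArg (fun p => p none) h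
      have := addPair_injective (mul_left_cancel (mul_right_cancel h))
      rw [Subtype.ext this]
    · rintro ⟨η, hη⟩
      obtain ⟨j, hj⟩ := Option.ne_none_iff_exists'.1 (hη.2 none)
      have hζ := conj_swap_isMatching (some none) (some j) η hη
      have h₀ : (Equiv.swap (some none) (some j) * η * Equiv.swap (some none) (some j)) none =
          some none := by
        simp [Equiv.swap_apply_of_ne_of_ne, hj]
      obtain ⟨ξ, hξ⟩ := exists_addPair_eq _ h₀ (by simpa only [h₀] using hζ.1 none)
      rw [← hξ] at hζ
      refine ⟨(j, ⟨ξ, addPair_isMatching.1 hζ⟩), Subtype.ext ?_⟩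
      simp [insertPair, hξ, mul_assoc]

theorem coe_matchingOptionEquiv (p : Option α × Matching α) :
    (matchingOptionEquiv p).1 = insertPair p.1 p.2.1 := rfl

/-- When the two new points are matched together, they get a color of their own. -/
def invariantColoringInsertNone (s ξ : Equiv.Perm α) :
    InvariantColoring (addPair s) (insertPair none ξ) ≃ Bool × InvariantColoring s ξ where
  toFun f := (f.1 none, ⟨fun x => f.1 (some (some x)), fun x => by
    simpa [insertPair] using f.2 (some (some x))⟩)
  invFun p := ⟨fun v => v.elim p.1 fun w => w.elim p.1 p.2.1, by
    simpa [insertPair, Option.forall] using p.2.2⟩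
  left_inv f := by
    ext (_ | _ | x)
    · rfl
    · simpa using (f.2 none).2.symm
    · rfl
  right_inv p := rfl

theorem invariantColoring_insertPair_iff (s ξ : Equiv.Perm α) (y : α)
    (f : Option (Option α) → Bool) :
    (∀ v, f (insertPair (some y) ξ v) = f v ∧ f (addPair s v) = f v) ↔
      (f none = f (some (some y)) ∧ f (some none) = f (some (some y))) ∧
        ∀ x, f (some (some (ξ x))) = f (some (some x)) ∧
          f (some (some (s x))) = f (some (some x)) := by
  have key (h : f (some none) = f (some (some y))) (v) :
      f (Equiv.swap (some none) (some (some y)) v) = f v := by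
    rw [Equiv.swap_apply_def]
    split_ifs <;> simp_all
  constructor
  · intro hf
    have h₁ : f (some (some y)) = f none := by
      simpa [insertPair_none_apply] using (hf none).1
    have h₂ : f (some none) = f none := by simpa using (hf none).2
    have h₃ := key (h₂.trans h₁.symm)
    refine ⟨⟨h₁.symm, h₂.trans h₁.symm⟩, fun x => ⟨?_, by simpa using (hf (some (some x))).2⟩⟩
    have := (hf (Equiv.swap (some none) (some (some y)) (some (some x)))).1
    simpa [insertPair, h₃] using this
  · rintro ⟨⟨h₁, h₂⟩, h⟩ v
    have h₃ := key h₂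
    constructor
    · have h₄ (u) : f (addPair ξ u) = f u := by
        rcases u with _ | _ | x <;> simp_all
      simp only [insertPair, Equiv.Perm.mul_apply, h₃, h₄]
    · rcases v with _ | _ | x <;> simp_all

/-- When a new point is matched with an old one, the colors of the new points are forced. -/
def invariantColoringInsertSome (s ξ : Equiv.Perm α) (y : α) :
    InvariantColoring (addPair s) (insertPair (some y) ξ) ≃ InvariantColoring s ξ where
  toFun f := ⟨fun x => f.1 (some (some x)),
    ((invariantColoring_insertPair_iff s ξ y f.1).1 f.2).2⟩
  invFun f := ⟨fun v => v.elim (f.1 y) fun w => w.elim (f.1 y) f.1,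
    (invariantColoring_insertPair_iff s ξ y fun v => v.elim (f.1 y) fun w => w.elim (f.1 y) f.1).2
      ⟨⟨rfl, rfl⟩, f.2⟩⟩
  left_inv f := by
    have h := ((invariantColoring_insertPair_iff s ξ y f.1).1 f.2).1
    ext (_ | _ | x)
    · exact h.1.symm
    · exact h.2.symm
    · rfl
  right_inv f := rfl

theorem coloredMatchings_addPair [Fintype α] (s : Equiv.Perm α) :
    coloredMatchings (addPair s) = (Fintype.card α + 2) * coloredMatchings s := by
  have h₀ (ξ : Equiv.Perm α) : Nat.card (InvariantColoring (addPair s) (insertPair none ξ)) =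
      2 * Nat.card (InvariantColoring s ξ) := by
    rw [Nat.card_congr (invariantColoringInsertNone s ξ), Nat.card_prod,
      Nat.card_eq_fintype_card (α := Bool), Fintype.card_bool]
  have h₁ (y : α) (ξ : Equiv.Perm α) :=
    Nat.card_congr (invariantColoringInsertSome s ξ y)
  unfold coloredMatchings
  rw [← matchingOptionEquiv.sum_comp, Fintype.sum_prod_type, Fintype.sum_option]
  simp only [coe_matchingOptionEquiv, h₀, h₁, ← Finset.mul_sum,
    Finset.sum_const, Finset.card_univ, smul_eq_mul]
  ring

end AddPair

theorem coloredMatchings_sigma0_succ (k : ℕ) :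
    coloredMatchings (sigma0 (k + 1)) = coloredMatchings (addPair (sigma0 k)) := by
  let e : Option (Option (Fin (2 * k))) ≃ Fin (2 * (k + 1)) :=
    (finSuccEquivLast.trans finSuccEquivLast.optionCongr).symm
  refine (coloredMatchings_congr e _ _ ?_).symm
  have he : e none = Fin.last (2 * k + 1) := by
    simp [e, Equiv.symm_apply_eq]
  have he' : e (some none) = (Fin.last (2 * k)).castSucc := by
    simp [e, Equiv.symm_apply_eq]
  have he'' (x) : e (some (some x)) = x.castSucc.castSucc := by
    simp [e, Equiv.symm_apply_eq]
  rintro (_ | _ | x) <;> apply Fin.ext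
  · simp [he, he', sigma0, Function.Involutive.toPerm]
  · simp [he, he', sigma0, Function.Involutive.toPerm]
  · simp [he'', sigma0, Function.Involutive.toPerm]

/-- The recursion `g(m) = 2m·g(m−1)` for `m ≥ 1`. -/
theorem g_recursion (m : ℕ) (hm : 1 ≤ m) : g m = 2 * m * g (m - 1) := by
  obtain ⟨k, rfl⟩ := Nat.exists_eq_add_of_le' hm
  rw [Nat.add_sub_cancel, g_eq_coloredMatchings, g_eq_coloredMatchings,
    coloredMatchings_sigma0_succ, coloredMatchings_addPair, Fintype.card_fin]
  ring
end

section
/- For every nonnegative integer m, Σ over perfect matchings ξ of Fin(2m) of 2^{c(ξ)} = (2m)!! = 2^m · m!, where c(ξ) is the number of connected components of the union graph of ξ and the fixed perfect matching σ₀ pairing 2j−1 with 2j for each j = 1, …, m. -/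
open Finset

/-- A two-colouring alternates along a permutation if each point and its image receive
different colours. -/
def Alternates {V : Type*} (f : V → Bool) (σ : Equiv.Perm V) : Prop :=
  ∀ i, f (σ i) = !f i

instance {V : Type*} [Fintype V] (f : V → Bool) (σ : Equiv.Perm V) :
    Decidable (Alternates f σ) :=
  inferInstanceAs (Decidable (∀ i, f (σ i) = !f i))

theorem not_sameCycle_mul_of_involutive {V : Type*} {σ τ : Equiv.Perm V}
    (hσ : ∀ i, σ (σ i) = i) (hσ' : ∀ i, σ i ≠ i) (hτ : ∀ i, τ (τ i) = i) (hτ' : ∀ i, τ i ≠ i)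
    (i : V) : ¬ (σ * τ).SameCycle i (τ i) := by
  have hττ : τ * τ = 1 := Equiv.ext hτ
  have hσσ : σ * σ = 1 := Equiv.ext hσ
  have hsemi : SemiconjBy τ (σ * τ) (σ * τ)⁻¹ := by
    rw [SemiconjBy, eq_inv_mul_iff_mul_eq]
    calc σ * τ * (τ * (σ * τ)) = σ * (τ * τ) * σ * τ := by group
      _ = τ := by rw [hττ, mul_one, hσσ, one_mul]
  have key (j : ℤ) : τ (((σ * τ) ^ j) i) = ((σ * τ) ^ (-j)) (τ i) := by
    have h := (hsemi.zpow_right j).eq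
    rw [inv_zpow'] at h
    exact congrArg (fun π : Equiv.Perm V => π i) h
  rintro ⟨k, hk⟩
  rcases Int.even_or_odd' k with ⟨j, rfl | rfl⟩
  · apply hτ' (((σ * τ) ^ j) i)
    rw [key, ← hk, ← Equiv.Perm.mul_apply, ← zpow_add]
    congr 2
    ring
  · apply hσ' (τ (((σ * τ) ^ j) i))
    rw [← Equiv.Perm.mul_apply, ← Equiv.Perm.mul_apply, key, ← hk,
      ← Equiv.Perm.mul_apply, ← zpow_add, ← zpow_one_add]
    congr 2
    ring

/-- Two fixed-point-free involutions admit a common alternating two-colouring. -/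
theorem exists_alternates {V : Type*} {σ τ : Equiv.Perm V}
    (hσ : ∀ i, σ (σ i) = i) (hσ' : ∀ i, σ i ≠ i) (hτ : ∀ i, τ (τ i) = i) (hτ' : ∀ i, τ i ≠ i) :
    ∃ f : V → Bool, Alternates f σ ∧ Alternates f τ := by
  classical
  let Q := Quotient (Equiv.Perm.SameCycle.setoid (σ * τ))
  let q : V → Q := Quotient.mk _
  let _ : LinearOrder Q := linearOrderOfSTO WellOrderingRel
  have hne (i) : q i ≠ q (τ i) := fun h =>
    not_sameCycle_mul_of_involutive hσ hσ' hτ hτ' i (Quotient.exact h)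
  have h₁ (i) : q (σ i) = q (τ i) := by
    refine (Quotient.sound (s := Equiv.Perm.SameCycle.setoid (σ * τ)) ⟨1, ?_⟩).symm
    simp [hτ]
  have h₂ (i) : q (τ (σ i)) = q i := by
    refine Quotient.sound (s := Equiv.Perm.SameCycle.setoid (σ * τ)) ⟨1, ?_⟩
    simp [hτ, hσ]
  have hswap (i) : decide (q (τ i) < q i) = !decide (q i < q (τ i)) := by
    rcases lt_or_gt_of_ne (hne i) with h | h <;> simp [h, h.not_gt]
  refine ⟨fun i => decide (q i < q (τ i)), fun i => ?_, fun i => ?_⟩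
  · simp only [h₁, h₂, hswap]
  · simp only [hτ, hswap]

theorem unionGraph_apply_eq_of_adj {α : Type*} {n : ℕ} {σ τ : Equiv.Perm (Fin n)}
    {f : Fin n → α} (hσ : ∀ i, f (σ i) = f i) (hτ : ∀ i, f (τ i) = f i) {i j : Fin n}
    (h : (unionGraph σ τ).Adj i j) : f i = f j := by
  rw [unionGraph, SimpleGraph.fromRel_adj] at h
  rcases h with ⟨-, (rfl | rfl) | (rfl | rfl)⟩ <;> simp [hσ, hτ]

theorem unionGraph_reachable_left {n : ℕ} (σ τ : Equiv.Perm (Fin n)) (i : Fin n) :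
    (unionGraph σ τ).Reachable (σ i) i := by
  by_cases h : σ i = i
  · rw [h]
  · exact SimpleGraph.Adj.reachable ((SimpleGraph.fromRel_adj _ _ _).2 ⟨h, by simp⟩)

theorem unionGraph_reachable_right {n : ℕ} (σ τ : Equiv.Perm (Fin n)) (i : Fin n) :
    (unionGraph σ τ).Reachable (τ i) i := by
  by_cases h : τ i = i
  · rw [h]
  · exact SimpleGraph.Adj.reachable ((SimpleGraph.fromRel_adj _ _ _).2 ⟨h, by simp⟩)

/-- Once a common alternating colouring is fixed, all others arise from it by flipping colours on
a set of connected components of the union graph. -/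
def alternatingEquiv {n : ℕ} {σ τ : Equiv.Perm (Fin n)} {f : Fin n → Bool}
    (hσ : Alternates f σ) (hτ : Alternates f τ) :
    {g : Fin n → Bool // Alternates g σ ∧ Alternates g τ} ≃
      ((unionGraph σ τ).ConnectedComponent → Bool) where
  toFun g c := c.lift (fun i => xor (g.1 i) (f i)) fun v w p _ => by
    induction p with
    | nil => rfl
    | cons h p ih =>
      refine (unionGraph_apply_eq_of_adj (f := fun i => xor (g.1 i) (f i)) ?_ ?_ h).trans
        (ih (by simp_all [SimpleGraph.Walk.cons_isPath_iff]))
      · intro i; simp [hσ i, g.2.1 i]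
      · intro i; simp [hτ i, g.2.2 i]
  invFun h := ⟨fun i => xor (h ((unionGraph σ τ).connectedComponentMk i)) (f i),
    fun i => by
      simp [SimpleGraph.ConnectedComponent.sound (unionGraph_reachable_left σ τ i), hσ i],
    fun i => by
      simp [SimpleGraph.ConnectedComponent.sound (unionGraph_reachable_right σ τ i), hτ i]⟩
  left_inv g := by ext i; simp
  right_inv h := by
    funext c
    induction c using SimpleGraph.ConnectedComponent.ind
    simp

theorem card_alternates_eq_two_pow {n : ℕ} {σ τ : Equiv.Perm (Fin n)}
    (hσ : IsPerfMatch σ) (hτ : IsPerfMatch τ) :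
    #{f : Fin n → Bool | Alternates f σ ∧ Alternates f τ} =
      2 ^ Nat.card (unionGraph σ τ).ConnectedComponent := by
  obtain ⟨f, hfσ, hfτ⟩ := exists_alternates hσ.1 hσ.2 hτ.1 hτ.2
  rw [← Fintype.card_subtype, ← Nat.card_eq_fintype_card,
    Nat.card_congr (alternatingEquiv hfσ hfτ), Nat.card_fun]
  simp

/-- Involutions alternating a two-colouring are the bijections between its colour classes. -/
def involutionEquiv {V : Type*} (f : V → Bool) :
    {ξ : Equiv.Perm V // (∀ i, ξ (ξ i) = i) ∧ Alternates f ξ} ≃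
      ({i // f i = true} ≃ {i // f i = false}) where
  toFun ξ :=
    { toFun := fun i => ⟨ξ.1 i, by simp [ξ.2.2 i.1, i.2]⟩
      invFun := fun i => ⟨ξ.1 i, by simp [ξ.2.2 i.1, i.2]⟩
      left_inv := fun i => Subtype.ext (ξ.2.1 i)
      right_inv := fun i => Subtype.ext (ξ.2.1 i) }
  invFun e :=
    have hinv : Function.Involutive fun i => if h : f i = true then (e ⟨i, h⟩ : V)
        else e.symm ⟨i, by simpa using h⟩ := fun i => by
      by_cases h : f i = true
      · have := (e ⟨i, h⟩).2
        simp [h, this]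
      · have := (e.symm ⟨i, by simpa using h⟩).2
        simp [h, this]
    ⟨hinv.toPerm, hinv, fun i => by
      by_cases h : f i = true
      · simpa [h] using (e ⟨i, h⟩).2
      · simpa [h] using (e.symm ⟨i, by simpa using h⟩).2⟩
  left_inv ξ := by
    ext i
    by_cases h : f i = true <;> simp
  right_inv e := by
    ext i
    simp [Function.Involutive.toPerm, i.2]

theorem card_perfMatch_alternates {m : ℕ} {τ : Equiv.Perm (Fin (2 * m))}
    (hτ : ∀ i, τ (τ i) = i) {f : Fin (2 * m) → Bool} (hf : Alternates f τ) :
    #{ξ ∈ PM (2 * m) | Alternates f ξ} = Nat.factorial m := by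
  let e := involutionEquiv f ⟨τ, hτ, hf⟩
  have hcard : Fintype.card {i // f i = true} = m := by
    have h := Fintype.card_subtype_compl (fun i => f i = true)
    have h' := Fintype.card_subtype_le (fun i => f i = true)
    have h'' := Fintype.card_congr e
    simp only [Bool.not_eq_true, Fintype.card_fin] at h h'
    omega
  have h := Fintype.card_congr (involutionEquiv f)
  rw [Fintype.card_equiv e, hcard, Fintype.card_subtype] at h
  rw [← h]
  congr 1
  ext ξ
  simp only [PM, IsPerfMatch, mem_filter, mem_univ, true_and]
  refine ⟨fun h => ⟨h.1.1, h.2⟩, fun h => ⟨⟨h.1, fun i hi => ?_⟩, h.2⟩⟩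
  have := h.2 i
  simp [hi] at this

theorem sigma0_val {m : ℕ} (i : Fin (2 * m)) :
    (sigma0 m i).val = if i.val % 2 = 0 then i.val + 1 else i.val - 1 := rfl

theorem isPerfMatch_sigma0 (m : ℕ) : IsPerfMatch (sigma0 m) := by
  refine ⟨fun i => Fin.ext ?_, fun i h => ?_⟩
  · simp only [sigma0_val]
    split_ifs <;> omega
  · have := congrArg Fin.val h
    rw [sigma0_val] at this
    split_ifs at this <;> omega

/-- A colouring alternating along `sigma0 m` is determined by its values at even points. -/
def alternatesSigma0Equiv (m : ℕ) :
    {f : Fin (2 * m) → Bool // Alternates f (sigma0 m)} ≃ (Fin m → Bool) where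
  toFun f j := f.1 ⟨2 * j, by omega⟩
  invFun g := ⟨fun i => xor (g ⟨i / 2, by omega⟩) (decide (i.val % 2 = 1)), fun i => by
    have h₁ : (sigma0 m i).val / 2 = i.val / 2 := by
      rw [sigma0_val]; split_ifs <;> omega
    have h₂ : (sigma0 m i).val % 2 = 1 ↔ ¬ i.val % 2 = 1 := by
      rw [sigma0_val]; split_ifs <;> omega
    simp only [h₁, h₂, decide_not, Bool.xor_not]⟩
  left_inv f := by
    ext i
    rcases Nat.mod_two_eq_zero_or_one i.val with h | h
    · have : (⟨2 * (i.val / 2), by omega⟩ : Fin (2 * m)) = i := Fin.ext (by simp; omega)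
      simp [this, h]
    · have : (⟨2 * (i.val / 2), by omega⟩ : Fin (2 * m)) = sigma0 m i :=
        Fin.ext (by simp [sigma0_val, h]; omega)
      simp [this, h, f.2 i]
  right_inv g := by
    funext j
    simp

open Nat in
/-- `Σ_{ξ ∈ PM(2m)} 2^{c(ξ)} = (2m)!! = 2^m·m!`, where `c(ξ)` is the number of connected
components of the union graph of `ξ` and the fixed matching `σ₀`. -/
theorem sum_two_pow_components_eq_doubleFactorial (m : ℕ) :
    ∑ ξ ∈ PM (2 * m), 2 ^ Nat.card (unionGraph ξ (sigma0 m)).ConnectedComponent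
      = (2 * m)‼
    ∧ (2 * m)‼ = 2 ^ m * Nat.factorial m := by
  refine ⟨?_, Nat.doubleFactorial_two_mul m⟩
  let S : Finset (Fin (2 * m) → Bool) := {f | Alternates f (sigma0 m)}
  have hS : #S = 2 ^ m := by
    rw [← Fintype.card_subtype, Fintype.card_congr (alternatesSigma0Equiv m)]
    simp
  calc ∑ ξ ∈ PM (2 * m), 2 ^ Nat.card (unionGraph ξ (sigma0 m)).ConnectedComponent
      = ∑ ξ ∈ PM (2 * m), #{f ∈ S | Alternates f ξ} := by
        refine sum_congr rfl fun ξ hξ => ?_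
        rw [← card_alternates_eq_two_pow (mem_filter.1 hξ).2 (isPerfMatch_sigma0 m),
          filter_filter]
        simp only [and_comm]
    _ = ∑ f ∈ S, #{ξ ∈ PM (2 * m) | Alternates f ξ} :=
        sum_card_bipartiteAbove_eq_sum_card_bipartiteBelow fun ξ f => Alternates f ξ
    _ = ∑ f ∈ S, m ! := sum_congr rfl fun f hf =>
        card_perfMatch_alternates (isPerfMatch_sigma0 m).1 (mem_filter.1 hf).2
    _ = (2 * m)‼ := by
        rw [sum_const, hS, smul_eq_mul, Nat.doubleFactorial_two_mul]
end

section
/- For every positive integer m, Σ over all ordered pairs (σ, τ) of perfect matchings of Fin(2m) of 2^{c(σ,τ)} = (2m)!, where c(σ,τ) is the number of connected components of the union graph of σ and τ. -/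
open Finset

open Equiv in
/-- For two fixed-point-free involutions `σ` and `τ`, no point `i` shares a cycle of `σ * τ`
with `σ i`. -/
lemma not_sameCycle_mul_apply {n : ℕ} {σ τ : Perm (Fin n)} (hσ : IsPerfMatch σ)
    (hτ : IsPerfMatch τ) (i : Fin n) : ¬ (σ * τ).SameCycle i (σ i) := by
  have hσσ : σ * σ = 1 := Perm.ext hσ.1
  have hττ : τ * τ = 1 := Perm.ext hτ.1
  have hσinv : σ⁻¹ = σ := inv_eq_of_mul_eq_one_right hσσ
  have hτinv : τ⁻¹ = τ := inv_eq_of_mul_eq_one_right hττ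
  have conj_zpow (j : ℤ) : σ * (σ * τ) ^ j = (σ * τ) ^ (-j) * σ := by
    have h : σ * (σ * τ) * σ⁻¹ = (σ * τ)⁻¹ := by
      rw [mul_inv_rev, hσinv, hτinv, ← mul_assoc, hσσ, one_mul]
    rw [zpow_neg, ← inv_zpow, ← h, conj_zpow, inv_mul_cancel_right]
  rintro ⟨k, hk⟩
  obtain ⟨j, rfl | rfl⟩ := k.even_or_odd'
  · apply hσ.2 (((σ * τ) ^ j) i)
    rw [← Perm.mul_apply, conj_zpow, Perm.mul_apply, ← hk, ← Perm.mul_apply, ← zpow_add]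
    congr 2
    ring
  · apply hτ.2 (((σ * τ) ^ j) i)
    apply σ.injective
    rw [← Perm.mul_apply σ τ, ← Perm.mul_apply (σ * τ), ← zpow_one_add, ← Perm.mul_apply σ,
      conj_zpow, Perm.mul_apply, ← hk, ← Perm.mul_apply, ← zpow_add]
    congr 2
    ring

/-- A set of vertices is swapped with its complement by `σ`. -/
def IsSwapped {n : ℕ} (σ : Equiv.Perm (Fin n)) (s : Finset (Fin n)) : Prop :=
  ∀ i, σ i ∈ s ↔ i ∉ s

instance {n : ℕ} (σ : Equiv.Perm (Fin n)) : DecidablePred (IsSwapped σ) := fun _ =>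
  Fintype.decidableForallFintype

/-- The union graph of two perfect matchings is bipartite. -/
lemma exists_isSwapped {n : ℕ} {σ τ : Equiv.Perm (Fin n)} (hσ : IsPerfMatch σ)
    (hτ : IsPerfMatch τ) : ∃ s, IsSwapped σ s ∧ IsSwapped τ s := by
  let rep (i : Fin n) : Fin n := (Quotient.mk (Equiv.Perm.SameCycle.setoid (σ * τ)) i).out
  have rep_eq {i j : Fin n} : rep i = rep j ↔ (σ * τ).SameCycle i j := by
    rw [Quotient.out_inj]
    exact Quotient.eq
  have rep_ne (i : Fin n) : rep i ≠ rep (σ i) := fun h =>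
    not_sameCycle_mul_apply hσ hτ i (rep_eq.1 h)
  have rep_mul (i : Fin n) : rep (σ (τ i)) = rep i :=
    rep_eq.2 (Equiv.Perm.sameCycle_apply_left.2 (Equiv.Perm.SameCycle.refl _ _))
  have rep_apply (i : Fin n) : rep (τ i) = rep (σ i) := by
    rw [← rep_mul (τ i), hτ.1]
  refine ⟨univ.filter fun i => rep i < rep (σ i), fun i => ?_, fun i => ?_⟩
  · simp only [mem_filter_univ, hσ.1, not_lt]
    exact ⟨le_of_lt, fun h => lt_of_le_of_ne h (rep_ne i).symm⟩
  · simp only [mem_filter_univ, rep_mul, rep_apply, not_lt]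
    exact ⟨le_of_lt, fun h => lt_of_le_of_ne h (rep_ne i).symm⟩

/-- The bipartitions of the union graph of two perfect matchings are counted by its
components. -/
lemma card_isSwapped {n : ℕ} {σ τ : Equiv.Perm (Fin n)} (hσ : IsPerfMatch σ)
    (hτ : IsPerfMatch τ) :
    #{s | IsSwapped σ s ∧ IsSwapped τ s} =
      2 ^ Nat.card (unionGraph σ τ).ConnectedComponent := by
  classical
  obtain ⟨t, hσt, hτt⟩ := exists_isSwapped hσ hτ
  let mk := (unionGraph σ τ).connectedComponentMk
  have adj_σ (i : Fin n) : mk (σ i) = mk i :=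
    SimpleGraph.ConnectedComponent.connectedComponentMk_eq_of_adj
      ((SimpleGraph.fromRel_adj _ _ _).2 ⟨hσ.2 i, Or.inr (Or.inl rfl)⟩)
  have adj_τ (i : Fin n) : mk (τ i) = mk i :=
    SimpleGraph.ConnectedComponent.connectedComponentMk_eq_of_adj
      ((SimpleGraph.fromRel_adj _ _ _).2 ⟨hτ.2 i, Or.inr (Or.inr rfl)⟩)
  let color (A : Set (unionGraph σ τ).ConnectedComponent) :
      {s // IsSwapped σ s ∧ IsSwapped τ s} :=
    ⟨univ.filter fun i => i ∈ t ↔ mk i ∈ A,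
      fun i => by simp only [mem_filter_univ, adj_σ, hσt i]; tauto,
      fun i => by simp only [mem_filter_univ, adj_τ, hτt i]; tauto⟩
  have color_bijective : Function.Bijective color := by
    constructor
    · intro A B h
      ext c
      induction c using SimpleGraph.ConnectedComponent.ind with
      | h i =>
        have hi := Finset.ext_iff.1 (Subtype.ext_iff.1 h) i
        simp only [color, mem_filter_univ, mk] at hi
        tauto
    · rintro ⟨s, hσs, hτs⟩
      have reach {i j : Fin n} (h : (unionGraph σ τ).Reachable i j) :
          (i ∈ t ↔ i ∈ s) ↔ (j ∈ t ↔ j ∈ s) := by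
        obtain ⟨w⟩ := h
        induction w with
        | nil => rfl
        | cons hadj _ ih =>
          rw [← ih]
          obtain ⟨-, (rfl | rfl) | (rfl | rfl)⟩ := (SimpleGraph.fromRel_adj _ _ _).1 hadj
          · rw [hσs, hσt]; tauto
          · rw [hτs, hτt]; tauto
          · rw [hσs, hσt]; tauto
          · rw [hτs, hτt]; tauto
      refine ⟨{c | ∃ i, mk i = c ∧ (i ∈ t ↔ i ∈ s)}, Subtype.ext (Finset.ext fun i => ?_)⟩
      have key : (∃ j, mk j = mk i ∧ (j ∈ t ↔ j ∈ s)) ↔ (i ∈ t ↔ i ∈ s) :=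
        ⟨fun ⟨_, hj, h⟩ => (reach (SimpleGraph.ConnectedComponent.exact hj)).1 h,
          fun h => ⟨i, rfl, h⟩⟩
      simp only [color, mem_filter_univ, Set.mem_ofPred_eq, key]
      by_cases hi : i ∈ t <;> simp [hi]
  have := Nat.card_congr (Equiv.ofBijective color color_bijective)
  rw [← Fintype.card_subtype, ← Nat.card_eq_fintype_card, ← this]
  have := Fintype.ofFinite (unionGraph σ τ).ConnectedComponent
  rw [Nat.card_eq_fintype_card, Nat.card_eq_fintype_card, Fintype.card_set]

/-- Perfect matchings swapping `s` with its complement are bijections from `s` to its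
complement. -/
def swappingEquiv {n : ℕ} (s : Finset (Fin n)) :
    {σ : Equiv.Perm (Fin n) // IsPerfMatch σ ∧ IsSwapped σ s} ≃ ({i // i ∈ s} ≃ {i // i ∉ s}) where
  toFun σ := σ.1.subtypeEquiv fun i => by rw [σ.2.2 i, not_not]
  invFun e :=
    have invol : Function.Involutive fun i =>
        if h : i ∈ s then (e ⟨i, h⟩ : Fin n) else e.symm ⟨i, h⟩ := fun i => by
      by_cases h : i ∈ s
      · have h' := (e ⟨i, h⟩).2
        simp [h, h']
      · have h' := (e.symm ⟨i, h⟩).2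
        simp [h, h']
    have swaps : IsSwapped invol.toPerm s := fun i => by
      by_cases h : i ∈ s
      · have h' := (e ⟨i, h⟩).2
        simp [h, h']
      · have h' := (e.symm ⟨i, h⟩).2
        simp [h, h']
    ⟨invol.toPerm, ⟨invol, fun i h => by have := swaps i; rw [h] at this; tauto⟩, swaps⟩
  left_inv σ := by
    ext i
    by_cases h : i ∈ s
    · simp [h]
    · simp only [Function.Involutive.coe_toPerm, h, dite_false]
      congr 1
      exact (Equiv.symm_apply_eq _).2 (σ.2.1.1 i).symm
  right_inv e := by
    ext i : 2
    exact dif_pos i.2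

lemma card_isPerfMatch_isSwapped (m : ℕ) (s : Finset (Fin (2 * m))) :
    #{σ ∈ PM (2 * m) | IsSwapped σ s} = if #s = m then m.factorial else 0 := by
  have hcard : #{σ ∈ PM (2 * m) | IsSwapped σ s} =
      Fintype.card ({i // i ∈ s} ≃ {i // i ∉ s}) := by
    rw [PM, filter_filter, ← Fintype.card_subtype, Fintype.card_congr (swappingEquiv s)]
  have hcompl : Fintype.card {i // i ∉ s} = 2 * m - #s := by
    rw [Fintype.card_subtype_compl, Fintype.card_fin, Fintype.card_coe]
  have hle : #s ≤ 2 * m := by simpa using s.card_le_univ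
  rw [hcard]
  split_ifs with h
  · rw [Fintype.card_equiv (Fintype.equivOfCardEq (by rw [hcompl, Fintype.card_coe]; omega)),
      Fintype.card_coe, h]
  · rw [Fintype.card_eq_zero_iff]
    refine ⟨fun e => h ?_⟩
    have := Fintype.card_congr e
    rw [hcompl, Fintype.card_coe] at this
    omega

/-- `Σ over ordered pairs (σ,τ) of perfect matchings of Fin 2m of 2^{c(σ,τ)} = (2m)!`,
where `c(σ,τ)` is the number of connected components of the union graph of `σ` and `τ`. -/
theorem sum_pairs_two_pow_components_eq_factorial (m : ℕ) (hm : 0 < m) :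
    ∑ σ ∈ PM (2 * m), ∑ τ ∈ PM (2 * m),
        2 ^ Nat.card (unionGraph σ τ).ConnectedComponent
      = Nat.factorial (2 * m) := by
  have hpair (σ) (hσ : σ ∈ PM (2 * m)) (τ) (hτ : τ ∈ PM (2 * m)) :
      2 ^ Nat.card (unionGraph σ τ).ConnectedComponent =
        ∑ s, (if IsSwapped σ s then 1 else 0) * (if IsSwapped τ s then 1 else 0) := by
    rw [← card_isSwapped (mem_filter.1 hσ).2 (mem_filter.1 hτ).2, card_filter]
    simp only [ite_zero_mul_ite_zero, mul_one]
  calc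
    _ = ∑ σ ∈ PM (2 * m), ∑ τ ∈ PM (2 * m), ∑ s,
          (if IsSwapped σ s then 1 else 0) * (if IsSwapped τ s then 1 else 0) :=
      sum_congr rfl fun σ hσ => sum_congr rfl fun τ hτ => hpair σ hσ τ hτ
    _ = ∑ s, #{σ ∈ PM (2 * m) | IsSwapped σ s} * #{τ ∈ PM (2 * m) | IsSwapped τ s} := by
      simp only [card_filter, sum_mul_sum]
      rw [sum_comm (s := univ)]
      exact sum_congr rfl fun _ _ => sum_comm
    _ = ∑ s : Finset (Fin (2 * m)), if #s = m then m.factorial * m.factorial else 0 := by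
      simp only [card_isPerfMatch_isSwapped, ite_zero_mul_ite_zero, and_self]
    _ = (2 * m).choose m * (m.factorial * m.factorial) := by
      rw [← sum_filter, sum_const, smul_eq_mul, univ_filter_card_eq, card_powersetCard,
        card_univ, Fintype.card_fin]
    _ = (2 * m).factorial := by
      have h := Nat.choose_mul_factorial_mul_factorial (show m ≤ 2 * m by omega)
      rwa [show 2 * m - m = m by omega, mul_assoc] at h
end
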